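/- arXiv:0711.4809 — 2 statements merged into one kernel-verified Lean document; each statement's English description precedes it below -/
import Mathlib

section
/- Let H ∈ (0,1) and let φ, ψ ∈ C_0^∞(ℝ) be real-valued. If X is fractional Brownian motion with Hurst index H, then E[(∫_ℝ φ'(t) X_t dt)(∫_ℝ ψ'(t) X_t dt)] = a_H · ∫_ℝ φ̂(ξ) ψ̂(ξ)‾ |ξ|^{1−2H} dξ, where a_H = sin(πH)·Γ(1+2H). -/
open MeasureTheory

/-- The Fourier transform `f̂(ξ) = (2π)^{-1/2} ∫ e^{-ixξ} f(x) dx`. -/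
noncomputable def fourierHat (f : ℝ → ℂ) (ξ : ℝ) : ℂ :=
  ((Real.sqrt (2 * Real.pi))⁻¹ : ℝ) * ∫ x : ℝ, Complex.exp (-(Complex.I * x * ξ)) * f x

/-- A nonnegative real function with nonzero Bochner integral `c` has lower Lebesgue integral `c`. -/
theorem lintegral_ofReal_eq_of_integral_eq {α : Type*} [MeasurableSpace α] {μ : Measure α}
    {f : α → ℝ} {c : ℝ} (hf : 0 ≤ᵐ[μ] f) (h : ∫ x, f x ∂μ = c) (hc : c ≠ 0) :
    ∫⁻ x, ENNReal.ofReal (f x) ∂μ = ENNReal.ofReal c := by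
  have hi : Integrable f μ := by
    by_contra hn
    exact hc (h ▸ integral_undef hn)
  rw [← h, ofReal_integral_eq_lintegral_ofReal hi hf]

theorem lintegral_rpow_mul_inv_one_add_sq {a : ℝ} (ha0 : 0 < a) (ha2 : a < 2) :
    ∫⁻ s in Set.Ioi (0 : ℝ), ENNReal.ofReal (s ^ (a - 1) * (1 + s ^ 2)⁻¹) =
      ENNReal.ofReal (Real.pi / (2 * Real.sin (Real.pi * (a / 2)))) := by
  have hG1 : 0 < Real.Gamma (a / 2) := Real.Gamma_pos_of_pos (by linarith)
  have hG2 : 0 < Real.Gamma (1 - a / 2) := Real.Gamma_pos_of_pos (by linarith)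
  have exp_int : ∀ s ∈ Set.Ioi (0 : ℝ),
      ENNReal.ofReal (s ^ (a - 1) * (1 + s ^ 2)⁻¹) =
      ∫⁻ y in Set.Ioi (0 : ℝ),
        ENNReal.ofReal (s ^ (a - 1) * Real.exp (-(1 + s ^ 2) * y)) := by
    intro s hs
    have hs : 0 < s := hs
    symm
    apply lintegral_ofReal_eq_of_integral_eq
    · exact Filter.Eventually.of_forall fun y => by positivity
    · rw [integral_const_mul, integral_exp_mul_Ioi (by nlinarith) 0]
      simp
      grind
    · positivity
  have gauss_int : ∀ y ∈ Set.Ioi (0 : ℝ),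
      ∫⁻ s in Set.Ioi (0 : ℝ),
        ENNReal.ofReal (s ^ (a - 1) * Real.exp (-(1 + s ^ 2) * y)) =
      ENNReal.ofReal (1 / 2 * Real.Gamma (a / 2) *
        (Real.exp (-y) * y ^ ((1 - a / 2) - 1))) := by
    intro y hy
    have hy : 0 < y := hy
    apply lintegral_ofReal_eq_of_integral_eq
    · filter_upwards [ae_restrict_mem measurableSet_Ioi] with s hs
      have hs : 0 < s := hs
      simp only [Pi.zero_apply]
      positivity
    · have h := integral_rpow_mul_exp_neg_mul_rpow (p := 2) (q := a - 1) (b := y)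
        (by norm_num) (by linarith) hy
      have h2 : ∀ s : ℝ, s ^ (a - 1) * Real.exp (-(1 + s ^ 2) * y) =
          Real.exp (-y) * (s ^ (a - 1) * Real.exp (-y * s ^ (2 : ℝ))) := by
        intro s
        rw [show -(1 + s ^ 2) * y = -y + -y * s ^ (2 : ℝ) by
          rw [Real.rpow_two]; ring, Real.exp_add]
        ring
      simp_rw [h2]
      rw [integral_const_mul, h, show -(a - 1 + 1) / 2 = (1 - a / 2) - 1 by ring,
        show (a - 1 + 1) / 2 = a / 2 by ring]
      ring
    · positivity
  rw [setLIntegral_congr_fun measurableSet_Ioi exp_int, lintegral_lintegral_swap (by fun_prop),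
    setLIntegral_congr_fun measurableSet_Ioi gauss_int]
  apply lintegral_ofReal_eq_of_integral_eq
  · filter_upwards [ae_restrict_mem measurableSet_Ioi] with y hy
    have hy : 0 < y := hy
    simp only [Pi.zero_apply]
    positivity
  · rw [integral_const_mul, ← Real.Gamma_eq_integral (by linarith), mul_assoc,
      Real.Gamma_mul_Gamma_one_sub]
    ring
  · have : 0 < Real.sin (Real.pi * (a / 2)) :=
      Real.sin_pos_of_pos_of_lt_pi (by positivity) (by nlinarith [Real.pi_pos])
    have := Real.pi_pos
    positivity

theorem integral_one_sub_cos_mul_exp {s : ℝ} (hs : 0 < s) :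
    ∫ x in Set.Ioi (0 : ℝ), (1 - Real.cos x) * Real.exp (-s * x) = s⁻¹ * (1 + s ^ 2)⁻¹ := by
  have hd : ∀ x : ℝ, HasDerivAt
      (fun x => Real.exp (-s * x) * (-s⁻¹ - (Real.sin x - s * Real.cos x) * (1 + s ^ 2)⁻¹))
      ((1 - Real.cos x) * Real.exp (-s * x)) x := by
    intro x
    have h1 : HasDerivAt (fun x => Real.exp (-s * x)) (Real.exp (-s * x) * (-s)) x := by
      simpa using ((hasDerivAt_id x).const_mul (-s)).exp
    have h2 := (((Real.hasDerivAt_sin x).sub ((Real.hasDerivAt_cos x).const_mul s)).mul_const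
      ((1 + s ^ 2)⁻¹)).const_sub (-s⁻¹)
    convert! h1.mul h2 using 1
    simp only [Pi.sub_apply]
    field_simp
    ring
  have hlim : Filter.Tendsto
      (fun x => Real.exp (-s * x) * (-s⁻¹ - (Real.sin x - s * Real.cos x) * (1 + s ^ 2)⁻¹))
      Filter.atTop (nhds 0) := by
    have he : Filter.Tendsto (fun x => Real.exp (-s * x)) Filter.atTop (nhds 0) :=
      Real.tendsto_exp_atBot.comp
        (Filter.tendsto_id.const_mul_atTop_of_neg (by linarith))
    refine he.zero_mul_isBoundedUnder_le ?_
    refine Filter.isBoundedUnder_of ⟨s⁻¹ + (1 + s) * (1 + s ^ 2)⁻¹, fun x => ?_⟩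
    simp only [Function.comp]
    refine (norm_sub_le _ _).trans ?_
    rw [norm_neg, norm_mul, Real.norm_of_nonneg (by positivity : 0 ≤ s⁻¹),
      Real.norm_of_nonneg (by positivity : 0 ≤ (1 + s ^ 2)⁻¹)]
    gcongr
    refine (norm_sub_le _ _).trans ?_
    rw [norm_mul, Real.norm_of_nonneg hs.le]
    have := Real.abs_sin_le_one x
    have := Real.abs_cos_le_one x
    simp only [Real.norm_eq_abs]
    nlinarith
  rw [integral_Ioi_of_hasDerivAt_of_nonneg' (fun x _ => hd x)
    (fun x _ => mul_nonneg (sub_nonneg.2 (Real.cos_le_one x)) (Real.exp_pos _).le) hlim]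
  simp
  field_simp
  ring

theorem lintegral_one_sub_cos_mul_rpow {a : ℝ} (ha0 : 0 < a) (ha2 : a < 2) :
    ∫⁻ x in Set.Ioi (0 : ℝ), ENNReal.ofReal ((1 - Real.cos x) * x ^ (-1 - a)) =
      ENNReal.ofReal (Real.pi / (2 * Real.sin (Real.pi * (a / 2)) * Real.Gamma (1 + a))) := by
  have hG : 0 < Real.Gamma (1 + a) := Real.Gamma_pos_of_pos (by linarith)
  have gamma_int : ∀ x ∈ Set.Ioi (0 : ℝ),
      ENNReal.ofReal ((1 - Real.cos x) * x ^ (-1 - a)) =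
      ∫⁻ s in Set.Ioi (0 : ℝ), ENNReal.ofReal
        ((Real.Gamma (1 + a))⁻¹ * s ^ a * ((1 - Real.cos x) * Real.exp (-s * x))) := by
    intro x hx
    have hx : 0 < x := hx
    have hc := Real.cos_le_one x
    rcases hc.eq_or_lt with hc | hc
    · simp [hc]
    symm
    apply lintegral_ofReal_eq_of_integral_eq
    · filter_upwards [ae_restrict_mem measurableSet_Ioi] with s hs
      have hs : 0 < s := hs
      have : 0 < 1 - Real.cos x := by linarith
      simp only [Pi.zero_apply]
      positivity
    · have h := integral_rpow_mul_exp_neg_mul_rpow (p := 1) (q := a) (b := x)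
        (by norm_num) (by linarith) hx
      have h2 : ∀ s : ℝ, (Real.Gamma (1 + a))⁻¹ * s ^ a * ((1 - Real.cos x) * Real.exp (-s * x)) =
          (Real.Gamma (1 + a))⁻¹ * (1 - Real.cos x) * (s ^ a * Real.exp (-x * s ^ (1 : ℝ))) := by
        intro s
        rw [Real.rpow_one, show -s * x = -x * s by ring]
        ring
      simp_rw [h2]
      rw [integral_const_mul, h, show -(a + 1) / 1 = -1 - a by ring,
        show (a + 1) / 1 = 1 + a by ring]
      field_simp
    · have : 0 < 1 - Real.cos x := by linarith
      positivity
  have cos_int : ∀ s ∈ Set.Ioi (0 : ℝ),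
      ∫⁻ x in Set.Ioi (0 : ℝ), ENNReal.ofReal
        ((Real.Gamma (1 + a))⁻¹ * s ^ a * ((1 - Real.cos x) * Real.exp (-s * x))) =
      ENNReal.ofReal (Real.Gamma (1 + a))⁻¹ *
        ENNReal.ofReal (s ^ (a - 1) * (1 + s ^ 2)⁻¹) := by
    intro s hs
    have hs : 0 < s := hs
    rw [← ENNReal.ofReal_mul (by positivity)]
    apply lintegral_ofReal_eq_of_integral_eq
    · refine Filter.Eventually.of_forall fun x => ?_
      have : 0 ≤ 1 - Real.cos x := sub_nonneg.2 (Real.cos_le_one x)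
      simp only [Pi.zero_apply]
      positivity
    · rw [integral_const_mul, integral_one_sub_cos_mul_exp hs, Real.rpow_sub_one hs.ne']
      ring
    · positivity
  rw [setLIntegral_congr_fun measurableSet_Ioi gamma_int, lintegral_lintegral_swap (by fun_prop),
    setLIntegral_congr_fun measurableSet_Ioi cos_int, lintegral_const_mul _ (by fun_prop),
    lintegral_rpow_mul_inv_one_add_sq ha0 ha2, ← ENNReal.ofReal_mul (by positivity)]
  congr 1
  field_simp

/-- The integral is homogeneous of degree `a` in `t`. -/
theorem integral_one_sub_cos_mul_abs_rpow {a : ℝ} (ha0 : 0 < a) (ha2 : a < 2) (t : ℝ) :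
    ∫ ξ : ℝ, (1 - Real.cos (t * ξ)) * |ξ| ^ (-1 - a) =
      Real.pi / (Real.sin (Real.pi * (a / 2)) * Real.Gamma (1 + a)) * |t| ^ a := by
  rcases eq_or_ne t 0 with rfl | ht
  · simp [Real.zero_rpow ha0.ne']
  have hsin : 0 < Real.sin (Real.pi * (a / 2)) :=
    Real.sin_pos_of_pos_of_lt_pi (by positivity) (by nlinarith [Real.pi_pos])
  have hG : 0 < Real.Gamma (1 + a) := Real.Gamma_pos_of_pos (by linarith)
  have ht' : 0 < |t| := abs_pos.2 ht
  have hbase : ∫ x in Set.Ioi (0 : ℝ), (1 - Real.cos x) * x ^ (-1 - a) =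
      Real.pi / (2 * Real.sin (Real.pi * (a / 2)) * Real.Gamma (1 + a)) := by
    rw [integral_eq_lintegral_of_nonneg_ae, lintegral_one_sub_cos_mul_rpow ha0 ha2,
      ENNReal.toReal_ofReal]
    · have := Real.pi_pos
      positivity
    · filter_upwards [ae_restrict_mem measurableSet_Ioi] with x hx
      exact mul_nonneg (sub_nonneg.2 (Real.cos_le_one x)) (Real.rpow_nonneg (le_of_lt hx) _)
    · exact Measurable.aestronglyMeasurable (by fun_prop)
  have habs : ∀ ξ : ℝ, (1 - Real.cos (t * ξ)) * |ξ| ^ (-1 - a) =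
      (fun y => (1 - Real.cos (|t| * y)) * y ^ (-1 - a)) |ξ| := by
    intro ξ
    simp only
    rw [← abs_mul, Real.cos_abs]
  refine (integral_congr_ae (Filter.Eventually.of_forall habs)).trans ?_
  rw [integral_comp_abs (f := fun y => (1 - Real.cos (|t| * y)) * y ^ (-1 - a))]
  have hscale : ∀ y ∈ Set.Ioi (0 : ℝ), (1 - Real.cos (|t| * y)) * y ^ (-1 - a) =
      |t| ^ (1 + a) * (fun x => (1 - Real.cos x) * x ^ (-1 - a)) (|t| * y) := by
    intro y hy
    simp only
    rw [Real.mul_rpow ht'.le (le_of_lt hy)]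
    have : |t| ^ (1 + a) * |t| ^ (-1 - a) = 1 := by
      rw [← Real.rpow_add ht']
      simp
    linear_combination -((1 - Real.cos (|t| * y)) * y ^ (-1 - a)) * this
  rw [setIntegral_congr_fun measurableSet_Ioi hscale, integral_const_mul,
    integral_comp_mul_left_Ioi (fun x => (1 - Real.cos x) * x ^ (-1 - a)) _ ht', mul_zero, hbase, Real.rpow_add ht', Real.rpow_one,
    smul_eq_mul]
  field_simp

theorem integrable_one_sub_cos_mul_abs_rpow {a : ℝ} (ha0 : 0 < a) (ha2 : a < 2) (t : ℝ) :
    Integrable (fun ξ : ℝ => (1 - Real.cos (t * ξ)) * |ξ| ^ (-1 - a)) := by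
  rcases eq_or_ne t 0 with rfl | ht
  · simp
  by_contra hn
  have h := integral_one_sub_cos_mul_abs_rpow ha0 ha2 t
  rw [integral_undef hn] at h
  have hsin : 0 < Real.sin (Real.pi * (a / 2)) :=
    Real.sin_pos_of_pos_of_lt_pi (by positivity) (by nlinarith [Real.pi_pos])
  have hG : 0 < Real.Gamma (1 + a) := Real.Gamma_pos_of_pos (by linarith)
  have ht' : 0 < |t| := abs_pos.2 ht
  have := Real.pi_pos
  have : 0 < Real.pi / (Real.sin (Real.pi * (a / 2)) * Real.Gamma (1 + a)) * |t| ^ a := by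
    positivity
  linarith

theorem norm_mul_conj_le (z w : ℂ) : ‖z * (starRingEnd ℂ) w‖ ≤ ‖z‖ ^ 2 + ‖w‖ ^ 2 := by
  rw [norm_mul, RCLike.norm_conj]
  nlinarith [sq_nonneg (‖z‖ - ‖w‖), sq_nonneg ‖z‖, sq_nonneg ‖w‖]

/-- Fubini for the pairing of two smoothed versions of a second-order process whose second moment
is `C * |t| ^ a` away from `t = 0`. -/
theorem integral_smoothed_mul_conj {S : Type*} [MeasurableSpace S] {μ : Measure S} [SFinite μ]
    {Y : ℝ → S → ℂ} (hY : Measurable (fun p : ℝ × S => Y p.1 p.2)) {C a : ℝ} (ha : 0 ≤ a)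
    (hint : ∀ t ≠ 0, Integrable (fun x => ‖Y t x‖ ^ 2) μ)
    (hsq : ∀ t ≠ 0, ∫ x, ‖Y t x‖ ^ 2 ∂μ = C * |t| ^ a)
    {f g : ℝ → ℂ} (hf : Continuous f) (hfc : HasCompactSupport f)
    (hg : Continuous g) (hgc : HasCompactSupport g) :
    ∫ x, (∫ t, f t * Y t x) * (starRingEnd ℂ) (∫ t, g t * Y t x) ∂μ =
      ∫ p : ℝ × ℝ, f p.1 * (starRingEnd ℂ) (g p.2) *
        ∫ x, Y p.1 x * (starRingEnd ℂ) (Y p.2 x) ∂μ := by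
  have hYm : ∀ t, Measurable (Y t) := fun t => hY.comp measurable_prodMk_left
  have hne : ∀ᵐ p : ℝ × ℝ, p.1 ≠ 0 ∧ p.2 ≠ 0 := by
    have h0 : ∀ᵐ t : ℝ, t ≠ 0 := by simp [ae_iff]
    exact (Measure.quasiMeasurePreserving_fst.ae h0).and
      (Measure.quasiMeasurePreserving_snd.ae h0)
  have hprod : ∀ t s, t ≠ 0 → s ≠ 0 →
      Integrable (fun x => Y t x * (starRingEnd ℂ) (Y s x)) μ := by
    intro t s ht hs
    refine ((hint t ht).add (hint s hs)).mono' ?_ (Filter.Eventually.of_forall fun x => ?_)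
    · exact ((hYm t).mul (Complex.continuous_conj.measurable.comp (hYm s))).aestronglyMeasurable
    · exact norm_mul_conj_le _ _
  have hYfst : Measurable (fun q : (ℝ × ℝ) × S => Y q.1.1 q.2) :=
    hY.comp (by fun_prop : Measurable fun q : (ℝ × ℝ) × S => (q.1.1, q.2))
  have hYsnd : Measurable (fun q : (ℝ × ℝ) × S => Y q.1.2 q.2) :=
    hY.comp (by fun_prop : Measurable fun q : (ℝ × ℝ) × S => (q.1.2, q.2))
  have hF : AEStronglyMeasurable (fun q : (ℝ × ℝ) × S => f q.1.1 * (starRingEnd ℂ) (g q.1.2) *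
      (Y q.1.1 q.2 * (starRingEnd ℂ) (Y q.1.2 q.2))) ((volume : Measure (ℝ × ℝ)).prod μ) := by
    refine Measurable.aestronglyMeasurable (Measurable.mul (Measurable.mul ?_ ?_)
      (hYfst.mul (Complex.continuous_conj.measurable.comp hYsnd)))
    · exact hf.measurable.comp (by fun_prop)
    · exact (Complex.continuous_conj.comp hg).measurable.comp (by fun_prop)
  have hpow : Continuous (fun t : ℝ => |t| ^ a) := continuous_abs.rpow_const fun _ => Or.inr ha
  have hbound : Integrable (fun p : ℝ × ℝ => (‖f p.1‖ * (C * |p.1| ^ a)) * ‖g p.2‖ +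
      ‖f p.1‖ * (‖g p.2‖ * (C * |p.2| ^ a))) := by
    have i1 : Integrable (fun t => ‖f t‖) := (hf.integrable_of_hasCompactSupport hfc).norm
    have i2 : Integrable (fun t => ‖g t‖) := (hg.integrable_of_hasCompactSupport hgc).norm
    have i3 : Integrable (fun t => ‖f t‖ * (C * |t| ^ a)) :=
      (hf.norm.mul (continuous_const.mul hpow)).integrable_of_hasCompactSupport hfc.norm.mul_right
    have i4 : Integrable (fun t => ‖g t‖ * (C * |t| ^ a)) :=
      (hg.norm.mul (continuous_const.mul hpow)).integrable_of_hasCompactSupport hgc.norm.mul_right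
    exact (i3.mul_prod i2).add (i1.mul_prod i4)
  have hFint : Integrable (fun q : (ℝ × ℝ) × S => f q.1.1 * (starRingEnd ℂ) (g q.1.2) *
      (Y q.1.1 q.2 * (starRingEnd ℂ) (Y q.1.2 q.2))) ((volume : Measure (ℝ × ℝ)).prod μ) := by
    rw [integrable_prod_iff hF]
    refine ⟨?_, hbound.mono' hF.norm.integral_prod_right' ?_⟩
    · filter_upwards [hne] with p hp
      exact (hprod _ _ hp.1 hp.2).const_mul _
    · filter_upwards [hne] with p hp
      rw [Real.norm_of_nonneg (integral_nonneg fun _ => norm_nonneg _)]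
      simp_rw [norm_mul (f p.1 * _)]
      rw [integral_const_mul]
      have hle : ∫ x, ‖Y p.1 x * (starRingEnd ℂ) (Y p.2 x)‖ ∂μ ≤
          C * |p.1| ^ a + C * |p.2| ^ a := by
        rw [← hsq _ hp.1, ← hsq _ hp.2, ← integral_add (hint _ hp.1) (hint _ hp.2)]
        exact integral_mono (hprod _ _ hp.1 hp.2).norm ((hint _ hp.1).add (hint _ hp.2))
          fun x => norm_mul_conj_le _ _
      refine (mul_le_mul_of_nonneg_left hle (norm_nonneg _)).trans (le_of_eq ?_)
      rw [norm_mul, RCLike.norm_conj]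
      ring
  calc ∫ x, (∫ t, f t * Y t x) * (starRingEnd ℂ) (∫ t, g t * Y t x) ∂μ
      = ∫ x, (∫ p : ℝ × ℝ, f p.1 * (starRingEnd ℂ) (g p.2) *
          (Y p.1 x * (starRingEnd ℂ) (Y p.2 x))) ∂μ := by
        congr 1 with x
        rw [← integral_conj, ← integral_prod_mul]
        refine integral_congr_ae (Filter.Eventually.of_forall fun p => ?_)
        simp only [map_mul]
        ring
    _ = ∫ p : ℝ × ℝ, ∫ x, f p.1 * (starRingEnd ℂ) (g p.2) *
          (Y p.1 x * (starRingEnd ℂ) (Y p.2 x)) ∂μ :=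
        (integral_integral_swap hFint).symm
    _ = _ := by simp_rw [integral_const_mul]

/-- The spectral measure `|ξ| ^ (-1 - a) dξ` of fractional Brownian motion with `a = 2H`. -/
noncomputable def fbmSpectralMeasure (a : ℝ) : Measure ℝ :=
  volume.withDensity fun ξ => ENNReal.ofReal (|ξ| ^ (-1 - a))

noncomputable instance (a : ℝ) : SFinite (fbmSpectralMeasure a) := by
  unfold fbmSpectralMeasure
  infer_instance

theorem integral_fbmSpectralMeasure {E : Type*} [NormedAddCommGroup E] [NormedSpace ℝ E] (a : ℝ)
    (h : ℝ → E) : ∫ ξ, h ξ ∂fbmSpectralMeasure a = ∫ ξ, |ξ| ^ (-1 - a) • h ξ := by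
  rw [fbmSpectralMeasure, integral_withDensity_eq_integral_toReal_smul (by fun_prop) (by simp)]
  congr 1 with ξ
  rw [ENNReal.toReal_ofReal (by positivity)]

theorem integrable_fbmSpectralMeasure_iff {E : Type*} [NormedAddCommGroup E] [NormedSpace ℝ E]
    (a : ℝ) (h : ℝ → E) :
    Integrable h (fbmSpectralMeasure a) ↔ Integrable (fun ξ => |ξ| ^ (-1 - a) • h ξ) := by
  rw [fbmSpectralMeasure, integrable_withDensity_iff_integrable_smul' (by fun_prop) (by simp)]
  refine integrable_congr (Filter.Eventually.of_forall fun ξ => ?_)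
  simp only
  rw [ENNReal.toReal_ofReal (by positivity)]

theorem integrable_one_sub_cos_fbmSpectralMeasure {a : ℝ} (ha0 : 0 < a) (ha2 : a < 2) (t : ℝ) :
    Integrable (fun ξ : ℝ => 1 - Real.cos (t * ξ)) (fbmSpectralMeasure a) := by
  rw [integrable_fbmSpectralMeasure_iff]
  simpa only [smul_eq_mul, mul_comm] using integrable_one_sub_cos_mul_abs_rpow ha0 ha2 t

theorem integral_one_sub_cos_fbmSpectralMeasure {a : ℝ} (ha0 : 0 < a) (ha2 : a < 2) (t : ℝ) :
    ∫ ξ : ℝ, (1 - Real.cos (t * ξ)) ∂fbmSpectralMeasure a =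
      Real.pi / (Real.sin (Real.pi * (a / 2)) * Real.Gamma (1 + a)) * |t| ^ a := by
  rw [integral_fbmSpectralMeasure, ← integral_one_sub_cos_mul_abs_rpow ha0 ha2 t]
  simp only [smul_eq_mul, mul_comm]

theorem exp_neg_I_mul_eq (t ξ : ℝ) : Complex.exp (-(Complex.I * t * ξ)) =
    (Real.cos (t * ξ) : ℂ) - (Real.sin (t * ξ) : ℂ) * Complex.I := by
  rw [show -(Complex.I * t * ξ) = ((-(t * ξ) : ℝ) : ℂ) * Complex.I by push_cast; ring,
    Complex.exp_mul_I, ← Complex.ofReal_cos, ← Complex.ofReal_sin, Real.cos_neg, Real.sin_neg]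
  push_cast
  ring

theorem norm_exp_neg_I_mul_sub_one_sq (t ξ : ℝ) :
    ‖Complex.exp (-(Complex.I * t * ξ)) - 1‖ ^ 2 = 2 * (1 - Real.cos (t * ξ)) := by
  rw [exp_neg_I_mul_eq, Complex.sq_norm, Complex.normSq_apply]
  simp [-Complex.ofReal_cos, -Complex.ofReal_sin]
  nlinarith [Real.sin_sq_add_cos_sq (t * ξ)]

theorem exp_sub_one_mul_conj_re (t s ξ : ℝ) :
    ((Complex.exp (-(Complex.I * t * ξ)) - 1) *
      (starRingEnd ℂ) (Complex.exp (-(Complex.I * s * ξ)) - 1)).re =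
    (1 - Real.cos (t * ξ)) + (1 - Real.cos (s * ξ)) - (1 - Real.cos ((t - s) * ξ)) := by
  rw [exp_neg_I_mul_eq, exp_neg_I_mul_eq, sub_mul t, Real.cos_sub]
  simp [-Complex.ofReal_cos, -Complex.ofReal_sin]
  ring

/-- The harmonizable representation of the covariance of fractional Brownian motion. -/
theorem integral_exp_sub_one_mul_conj {a : ℝ} (ha0 : 0 < a) (ha2 : a < 2) (t s : ℝ) :
    ∫ ξ : ℝ, (Complex.exp (-(Complex.I * t * ξ)) - 1) *
      (starRingEnd ℂ) (Complex.exp (-(Complex.I * s * ξ)) - 1) ∂fbmSpectralMeasure a =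
    ((Real.pi / (Real.sin (Real.pi * (a / 2)) * Real.Gamma (1 + a)) *
      (|t| ^ a + |s| ^ a - |t - s| ^ a) : ℝ) : ℂ) := by
  set C := Real.pi / (Real.sin (Real.pi * (a / 2)) * Real.Gamma (1 + a))
  have hc := integrable_one_sub_cos_fbmSpectralMeasure ha0 ha2
  have hI := integral_one_sub_cos_fbmSpectralMeasure ha0 ha2
  have hint : Integrable (fun ξ : ℝ => (Complex.exp (-(Complex.I * t * ξ)) - 1) *
      (starRingEnd ℂ) (Complex.exp (-(Complex.I * s * ξ)) - 1)) (fbmSpectralMeasure a) := by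
    refine (((hc t).const_mul 2).add ((hc s).const_mul 2)).mono' ?_
      (Filter.Eventually.of_forall fun ξ => ?_)
    · exact Continuous.aestronglyMeasurable (by fun_prop)
    · refine (norm_mul_conj_le _ _).trans (le_of_eq ?_)
      rw [norm_exp_neg_I_mul_sub_one_sq, norm_exp_neg_I_mul_sub_one_sq]
      rfl
  apply Complex.ext
  · rw [Complex.ofReal_re]
    refine (integral_re hint).symm.trans ?_
    refine (integral_congr_ae (Filter.Eventually.of_forall fun ξ =>
      exp_sub_one_mul_conj_re t s ξ)).trans ?_
    rw [integral_sub (f := fun ξ : ℝ => (1 - Real.cos (t * ξ)) + (1 - Real.cos (s * ξ)))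
      ((hc t).add (hc s)) (hc (t - s)), integral_add (hc t) (hc s), hI, hI, hI]
    ring
  · rw [Complex.ofReal_im]
    refine (integral_im hint).symm.trans ?_
    rw [integral_fbmSpectralMeasure]
    set h : ℝ → ℝ := fun ξ => |ξ| ^ (-1 - a) • RCLike.im
      ((Complex.exp (-(Complex.I * t * ξ)) - 1) *
        (starRingEnd ℂ) (Complex.exp (-(Complex.I * s * ξ)) - 1)) with hh
    have hodd : ∀ ξ, h (-ξ) = -h ξ := by
      intro ξ
      simp only [hh, abs_neg, exp_neg_I_mul_eq, mul_neg, Real.cos_neg, Real.sin_neg]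
      simp [-Complex.ofReal_cos, -Complex.ofReal_sin]
      ring
    have h1 := integral_neg_eq_self h volume
    simp_rw [hodd] at h1
    rw [integral_neg] at h1
    linarith

theorem integral_deriv_mul_exp_sub_one {f : ℝ → ℝ} (hf : ContDiff ℝ (⊤ : ℕ∞) f)
    (hfc : HasCompactSupport f) (ξ : ℝ) :
    ∫ t : ℝ, ((deriv f t : ℝ) : ℂ) * (Complex.exp (-(Complex.I * t * ξ)) - 1) =
      Complex.I * ξ * (Real.sqrt (2 * Real.pi) : ℝ) * fourierHat (fun t => (f t : ℂ)) ξ := by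
  have hd : ∀ t : ℝ, HasDerivAt (fun t : ℝ => ((f t : ℝ) : ℂ)) ((deriv f t : ℝ) : ℂ) t := fun t =>
    ((hf.differentiable (by simp)) t).hasDerivAt.ofReal_comp
  have he : ∀ t : ℝ, HasDerivAt (fun t : ℝ => Complex.exp (-(Complex.I * t * ξ)) - 1)
      (-(Complex.I * ξ) * Complex.exp (-(Complex.I * t * ξ))) t := by
    intro t
    have h1 : HasDerivAt (fun t : ℝ => -(Complex.I * t * ξ)) (-(Complex.I * ξ)) t := by
      have h0 : HasDerivAt (fun t : ℝ => (t : ℂ)) 1 t := (hasDerivAt_id t).ofReal_comp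
      simpa using ((h0.const_mul Complex.I).mul_const (ξ : ℂ)).fun_neg
    convert! h1.cexp.sub_const 1 using 1
    ring
  have hfC : HasCompactSupport (fun t : ℝ => ((f t : ℝ) : ℂ)) :=
    hfc.comp_left (g := fun x : ℝ => (x : ℂ)) (by simp)
  have hdC : HasCompactSupport (fun t : ℝ => ((deriv f t : ℝ) : ℂ)) :=
    hfc.deriv.comp_left (g := fun x : ℝ => (x : ℂ)) (by simp)
  have hcont : Continuous (fun t : ℝ => ((f t : ℝ) : ℂ)) :=
    Complex.continuous_ofReal.comp hf.continuous
  have hdcont : Continuous (fun t : ℝ => ((deriv f t : ℝ) : ℂ)) :=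
    Complex.continuous_ofReal.comp (hf.continuous_deriv (by simp))
  have hparts := integral_mul_deriv_eq_deriv_mul_of_integrable
    (u := fun t : ℝ => Complex.exp (-(Complex.I * t * ξ)) - 1)
    (v := fun t : ℝ => ((f t : ℝ) : ℂ)) (fun t _ => he t) (fun t _ => hd t)
    (Continuous.integrable_of_hasCompactSupport (by fun_prop) hdC.mul_left)
    (Continuous.integrable_of_hasCompactSupport (by fun_prop) hfC.mul_left)
    (Continuous.integrable_of_hasCompactSupport (by fun_prop) hfC.mul_left)
  have hsqrt : ((Real.sqrt (2 * Real.pi) : ℝ) : ℂ) ≠ 0 := by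
    rw [Complex.ofReal_ne_zero]
    exact (Real.sqrt_pos.2 (by positivity)).ne'
  simp_rw [mul_comm ((deriv f _ : ℝ) : ℂ)]
  rw [hparts, fourierHat, Complex.ofReal_inv]
  simp_rw [mul_assoc (-(Complex.I * (ξ : ℂ)))]
  rw [integral_const_mul]
  field_simp

/-- For FBM `X` with Hurst index `H ∈ (0,1)` and real `φ, ψ ∈ C_0^∞(ℝ)`:
`E[(∫ φ'(t) X_t dt)(∫ ψ'(t) X_t dt)] = a_H ∫ φ̂(ξ) conj(ψ̂(ξ)) |ξ|^{1−2H} dξ`,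
where `a_H = sin(πH) Γ(1+2H)`. -/
theorem fbm_integral_covariance_fourier
    {Ω : Type*} [MeasurableSpace Ω] (P : Measure Ω) [IsProbabilityMeasure P]
    (X : ℝ → Ω → ℝ) (H : ℝ) (hH0 : 0 < H) (hH1 : H < 1)
    (hmeas : Measurable (fun p : ℝ × Ω => X p.1 p.2))
    (hcov : ∀ u v : ℝ, ∫ ω, X u ω * X v ω ∂P =
      (|u| ^ (2 * H) + |v| ^ (2 * H) - |u - v| ^ (2 * H)) / 2)
    (φ ψ : ℝ → ℝ) (hφ : ContDiff ℝ (⊤ : ℕ∞) φ) (hφc : HasCompactSupport φ)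
    (hψ : ContDiff ℝ (⊤ : ℕ∞) ψ) (hψc : HasCompactSupport ψ) :
    ((∫ ω, (∫ t : ℝ, deriv φ t * X t ω) * (∫ t : ℝ, deriv ψ t * X t ω) ∂P : ℝ) : ℂ) =
      ((Real.sin (Real.pi * H) * Real.Gamma (1 + 2 * H) : ℝ) : ℂ) *
        ∫ ξ : ℝ, fourierHat (fun t => (φ t : ℂ)) ξ *
          (starRingEnd ℂ) (fourierHat (fun t => (ψ t : ℂ)) ξ) *
          ((|ξ| ^ (1 - 2 * H) : ℝ) : ℂ) := by
  have ha0 : 0 < 2 * H := by linarith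
  have ha2 : 2 * H < 2 := by linarith
  have hφ' : Continuous (fun t : ℝ => ((deriv φ t : ℝ) : ℂ)) :=
    Complex.continuous_ofReal.comp (hφ.continuous_deriv (by simp))
  have hψ' : Continuous (fun t : ℝ => ((deriv ψ t : ℝ) : ℂ)) :=
    Complex.continuous_ofReal.comp (hψ.continuous_deriv (by simp))
  have hφc' : HasCompactSupport (fun t : ℝ => ((deriv φ t : ℝ) : ℂ)) :=
    hφc.deriv.comp_left (g := fun x : ℝ => (x : ℂ)) (by simp)
  have hψc' : HasCompactSupport (fun t : ℝ => ((deriv ψ t : ℝ) : ℂ)) :=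
    hψc.deriv.comp_left (g := fun x : ℝ => (x : ℂ)) (by simp)
  have hvar : ∀ t, ∫ ω, X t ω ^ 2 ∂P = 1 * |t| ^ (2 * H) := by
    intro t
    simp_rw [sq]
    rw [hcov, sub_self, abs_zero, Real.zero_rpow ha0.ne']
    ring
  have hprob := integral_smoothed_mul_conj (μ := P) (Y := fun t ω => ((X t ω : ℝ) : ℂ))
    (Complex.measurable_ofReal.comp hmeas) (C := 1) (a := 2 * H) ha0.le
    (fun t ht => by
      simp only [Complex.norm_real, Real.norm_eq_abs, sq_abs]
      by_contra hn
      have h := hvar t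
      rw [integral_undef hn] at h
      have : 0 < |t| := abs_pos.2 ht
      have : 0 < 1 * |t| ^ (2 * H) := by positivity
      linarith)
    (fun t _ => by
      simp only [Complex.norm_real, Real.norm_eq_abs, sq_abs]
      exact hvar t) hφ' hφc' hψ' hψc'
  have hspec := integral_smoothed_mul_conj (μ := fbmSpectralMeasure (2 * H))
    (Y := fun t ξ => Complex.exp (-(Complex.I * t * ξ)) - 1)
    (Continuous.measurable (by fun_prop))
    (C := 2 * (Real.pi / (Real.sin (Real.pi * ((2 * H) / 2)) * Real.Gamma (1 + 2 * H))))
    (a := 2 * H) ha0.le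
    (fun t _ => by
      simp_rw [norm_exp_neg_I_mul_sub_one_sq]
      exact (integrable_one_sub_cos_fbmSpectralMeasure ha0 ha2 t).const_mul 2)
    (fun t _ => by
      simp_rw [norm_exp_neg_I_mul_sub_one_sq]
      rw [integral_const_mul, integral_one_sub_cos_fbmSpectralMeasure ha0 ha2, mul_assoc])
    hφ' hφc' hψ' hψc'
  have hsin : 0 < Real.sin (Real.pi * H) :=
    Real.sin_pos_of_pos_of_lt_pi (by positivity) (by nlinarith [Real.pi_pos])
  have hG : 0 < Real.Gamma (1 + 2 * H) := Real.Gamma_pos_of_pos (by linarith)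
  have hA : (Real.sin (Real.pi * H) : ℂ) * (Real.Gamma (1 + 2 * H) : ℂ) ≠ 0 := by
    exact_mod_cast (mul_pos hsin hG).ne'
  have hpi : (Real.pi : ℂ) ≠ 0 := by exact_mod_cast Real.pi_ne_zero
  have hcovC : ∀ t s : ℝ, ∫ ω, ((X t ω : ℝ) : ℂ) * (starRingEnd ℂ) ((X s ω : ℝ) : ℂ) ∂P =
      ((Real.sin (Real.pi * H) * Real.Gamma (1 + 2 * H) / (2 * Real.pi) : ℝ) : ℂ) *
      ∫ ξ : ℝ, (Complex.exp (-(Complex.I * t * ξ)) - 1) *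
        (starRingEnd ℂ) (Complex.exp (-(Complex.I * s * ξ)) - 1) ∂fbmSpectralMeasure (2 * H) := by
    intro t s
    rw [integral_exp_sub_one_mul_conj ha0 ha2, ← Complex.ofReal_mul]
    simp_rw [Complex.conj_ofReal, ← Complex.ofReal_mul]
    rw [integral_complex_ofReal, hcov, mul_div_cancel_left₀ H two_ne_zero]
    congr 1
    field_simp
    rw [mul_comm H, mul_div_cancel_right₀ _ hsin.ne']
  simp_rw [hcovC, mul_left_comm _ (((_ : ℝ)) : ℂ) (∫ ξ : ℝ, _ ∂fbmSpectralMeasure _)] at hprob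
  rw [integral_const_mul, ← hspec] at hprob
  simp_rw [integral_deriv_mul_exp_sub_one hφ hφc, integral_deriv_mul_exp_sub_one hψ hψc] at hprob
  have hL : ((∫ ω, (∫ t : ℝ, deriv φ t * X t ω) * (∫ t : ℝ, deriv ψ t * X t ω) ∂P : ℝ) : ℂ) =
      ∫ ω, (∫ t : ℝ, ((deriv φ t : ℝ) : ℂ) * ((X t ω : ℝ) : ℂ)) *
        (starRingEnd ℂ) (∫ t : ℝ, ((deriv ψ t : ℝ) : ℂ) * ((X t ω : ℝ) : ℂ)) ∂P := by
    simp_rw [← Complex.ofReal_mul, integral_complex_ofReal, Complex.conj_ofReal,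
      ← Complex.ofReal_mul, integral_complex_ofReal]
  rw [hL, hprob, integral_fbmSpectralMeasure, ← integral_const_mul, ← integral_const_mul]
  have h0 : ∀ᵐ ξ : ℝ, ξ ≠ 0 := by simp [ae_iff]
  refine integral_congr_ae ?_
  filter_upwards [h0] with ξ hξ
  have hξ' : 0 < |ξ| := abs_pos.2 hξ
  have hpow : ((|ξ| ^ (1 - 2 * H) : ℝ) : ℂ) = ((|ξ| ^ (-1 - 2 * H) : ℝ) : ℂ) * (ξ : ℂ) ^ 2 := by
    rw [← Complex.ofReal_pow, ← Complex.ofReal_mul, ← sq_abs ξ, ← Real.rpow_two,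
      ← Real.rpow_add hξ']
    ring_nf
  have hsqrt : ((Real.sqrt (2 * Real.pi) : ℝ) : ℂ) ^ 2 = 2 * (Real.pi : ℂ) := by
    rw [← Complex.ofReal_pow, Real.sq_sqrt (by positivity)]
    push_cast
    ring
  simp only [map_mul, Complex.conj_I, Complex.conj_ofReal, Complex.real_smul]
  rw [hpow]
  push_cast
  field_simp
  rw [hsqrt, Complex.I_sq]
  ring
end

section
/- Let s ∈ (−1/2, 1/2), α > 1/2 + s, α ≠ 1, and k > 0. Then sup { ∫_{−∞}^0 (k−x)^{−α} φ(x) dx : ‖φ‖_{W̃^{s,2}} ≤ 1, φ ∈ C_0^∞((−∞,0)) } = c(α,s) · k^{1/2+s−α} for a finite positive constant c(α,s) independent of k. -/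
open MeasureTheory

/-- The squared homogeneous Sobolev norm `‖f‖²_{W̃^{s,2}(ℝ)} = ∫ |f̂(ξ)|² |ξ|^{2s} dξ`. -/
noncomputable def homSobolevNormSq (s : ℝ) (f : ℝ → ℂ) : ENNReal :=
  ∫⁻ ξ : ℝ, (‖fourierHat f ξ‖₊ : ENNReal) ^ 2 * ENNReal.ofReal (|ξ| ^ (2 * s))

theorem lintegral_comp_mul_left_of_pos (f : ℝ → ENNReal) {a : ℝ} (ha : 0 < a) :
    ∫⁻ x, f (a * x) = ENNReal.ofReal a⁻¹ * ∫⁻ x, f x := by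
  have h := lintegral_map_equiv (μ := (volume : Measure ℝ)) f (MeasurableEquiv.mulLeft₀ a ha.ne')
  simp only [MeasurableEquiv.coe_mulLeft₀] at h
  rw [← h, Real.map_volume_mul_left ha.ne', lintegral_smul_measure, abs_of_pos (inv_pos.2 ha),
    smul_eq_mul]

theorem fourierHat_eq_fourier (f : ℝ → ℂ) (ξ : ℝ) :
    fourierHat f ξ =
      ((Real.sqrt (2 * Real.pi))⁻¹ : ℝ) * FourierTransform.fourier f ((2 * Real.pi)⁻¹ * ξ) := by
  rw [fourierHat, Real.fourier_real_eq_integral_exp_smul]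
  congr 2
  ext x
  rw [smul_eq_mul]
  congr 2
  have : (Real.pi : ℂ) ≠ 0 := by exact_mod_cast Real.pi_ne_zero
  push_cast
  field_simp

theorem fourierHat_const_mul_comp_inv_mul (f : ℝ → ℂ) (b : ℂ) {l : ℝ} (hl : 0 < l) (ξ : ℝ) :
    fourierHat (fun x => b * f (l⁻¹ * x)) ξ = b * l * fourierHat f (l * ξ) := by
  have h := Measure.integral_comp_mul_left
    (fun x : ℝ => Complex.exp (-(Complex.I * x * ((l * ξ : ℝ) : ℂ))) * f x) l⁻¹
  rw [inv_inv, abs_of_pos hl, Complex.real_smul] at h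
  simp only [fourierHat]
  rw [mul_left_comm, mul_assoc b, ← h, ← integral_const_mul b]
  refine congrArg (((Real.sqrt (2 * Real.pi))⁻¹ : ℝ) * · : ℂ → ℂ)
    (integral_congr_ae (.of_forall fun x => ?_))
  dsimp only
  have : (l : ℂ) ≠ 0 := by exact_mod_cast hl.ne'
  have e : Complex.I * ((l⁻¹ * x : ℝ) : ℂ) * ((l * ξ : ℝ) : ℂ) = Complex.I * x * ξ := by
    push_cast
    field_simp
  rw [e]
  ring

theorem homSobolevNormSq_const_mul_comp_inv_mul (s : ℝ) (f : ℝ → ℂ) {b l : ℝ} (hb : 0 ≤ b)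
    (hl : 0 < l) :
    homSobolevNormSq s (fun x => b * f (l⁻¹ * x)) =
      ENNReal.ofReal (b ^ 2 * l ^ (1 - 2 * s)) * homSobolevNormSq s f := by
  have h := lintegral_comp_mul_left_of_pos (fun ξ : ℝ =>
    (‖fourierHat f ξ‖₊ : ENNReal) ^ 2 * ENNReal.ofReal (|ξ| ^ (2 * s))) hl
  have e : b ^ 2 * l ^ (1 - 2 * s) = (b * l) ^ 2 * (l ^ (2 * s))⁻¹ * l⁻¹ := by
    rw [Real.rpow_sub hl, Real.rpow_one]
    have := (Real.rpow_pos_of_pos hl (2 * s)).ne'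
    field_simp
  have hp := Real.rpow_pos_of_pos hl (2 * s)
  rw [e, ENNReal.ofReal_mul (by positivity), mul_assoc, homSobolevNormSq, homSobolevNormSq, ← h,
    ← lintegral_const_mul' _ _ ENNReal.ofReal_ne_top]
  congr 1
  ext ξ
  rw [fourierHat_const_mul_comp_inv_mul f b hl, nnnorm_mul, ENNReal.coe_mul, mul_pow,
    abs_mul, abs_of_pos hl, Real.mul_rpow hl.le (abs_nonneg _), ENNReal.ofReal_mul hp.le,
    ENNReal.ofReal_mul (by positivity)]
  have e1 : ((‖(b : ℂ) * (l : ℂ)‖₊ : NNReal) : ENNReal) = ENNReal.ofReal (b * l) := by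
    rw [← Complex.ofReal_mul, ← enorm_eq_nnnorm, ← ofReal_norm, Complex.norm_real,
      Real.norm_of_nonneg (by positivity)]
  have e2 : ENNReal.ofReal (l ^ (2 * s))⁻¹ * ENNReal.ofReal (l ^ (2 * s)) = 1 := by
    rw [← ENNReal.ofReal_mul (by positivity), inv_mul_cancel₀ hp.ne', ENNReal.ofReal_one]
  rw [e1, ENNReal.ofReal_pow (by positivity)]
  calc _ = ENNReal.ofReal (b * l) ^ 2 * (‖fourierHat f (l * ξ)‖₊ : ENNReal) ^ 2
        * ENNReal.ofReal (|ξ| ^ (2 * s)) * 1 := by ring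
    _ = _ := by rw [← e2]; ring

theorem integrable_abs_rpow_mul_inv_one_add_sq {a : ℝ} (h1 : -1 < a) (h2 : a < 1) :
    Integrable (fun x : ℝ => |x| ^ a * (1 + x ^ 2)⁻¹) := by
  have hm : Measurable (fun x : ℝ => |x| ^ a * (1 + x ^ 2)⁻¹) := by fun_prop
  have hpos : IntegrableOn (fun x : ℝ => |x| ^ a * (1 + x ^ 2)⁻¹) (Set.Ioi 0) := by
    rw [← Set.Ioc_union_Ioi_eq_Ioi zero_le_one]
    refine IntegrableOn.union ?_ ?_
    · have h := (intervalIntegral.intervalIntegrable_rpow' (a := 0) (b := 1) h1)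
      rw [intervalIntegrable_iff_integrableOn_Ioc_of_le zero_le_one] at h
      refine Integrable.mono' h hm.aestronglyMeasurable ?_
      filter_upwards [ae_restrict_mem measurableSet_Ioc] with x hx
      rw [Real.norm_of_nonneg (by positivity), abs_of_pos hx.1]
      exact mul_le_of_le_one_right (Real.rpow_nonneg hx.1.le _)
        (inv_le_one_of_one_le₀ (by nlinarith [sq_nonneg x]))
    · have h := integrableOn_Ioi_rpow_of_lt (a := a - 2) (by linarith) zero_lt_one
      refine Integrable.mono' h hm.aestronglyMeasurable ?_
      filter_upwards [ae_restrict_mem measurableSet_Ioi] with x hx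
      have hx0 : 0 < x := zero_lt_one.trans hx
      rw [Real.norm_of_nonneg (by positivity), abs_of_pos hx0, Real.rpow_sub hx0, div_eq_mul_inv,
        Real.rpow_two]
      have := Real.rpow_nonneg hx0.le a
      gcongr
      linarith
  have hneg := hpos.comp_neg
  simp only [abs_neg, neg_sq, Set.neg_Ioi, neg_zero] at hneg
  rw [← integrableOn_univ, ← Set.Iio_union_Ici (a := (0 : ℝ))]
  exact hneg.union ((integrableOn_Ici_iff_integrableOn_Ioi (by simp)).2 hpos)

theorem lintegral_abs_rpow_mul_inv_sq_add_sq (a : ℝ) {t : ℝ} (ht : 0 < t) :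
    ∫⁻ ξ : ℝ, ENNReal.ofReal (|ξ| ^ a * (t ^ 2 + ξ ^ 2)⁻¹) =
      ENNReal.ofReal (t ^ (a - 1)) * ∫⁻ ξ : ℝ, ENNReal.ofReal (|ξ| ^ a * (1 + ξ ^ 2)⁻¹) := by
  have h := lintegral_comp_mul_left_of_pos
    (fun ξ : ℝ => ENNReal.ofReal (|ξ| ^ a * (1 + ξ ^ 2)⁻¹)) (inv_pos.2 ht)
  have hp := Real.rpow_pos_of_pos ht a
  have e : t ^ (a - 1) = t ^ a * (t ^ 2)⁻¹ * t := by
    rw [Real.rpow_sub ht, Real.rpow_one]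
    field_simp
  rw [inv_inv] at h
  rw [e, ENNReal.ofReal_mul (by positivity), mul_assoc, ← h,
    ← lintegral_const_mul' _ _ ENNReal.ofReal_ne_top]
  congr 1
  ext ξ
  rw [← ENNReal.ofReal_mul (by positivity), abs_mul, abs_of_pos (inv_pos.2 ht),
    Real.mul_rpow (inv_pos.2 ht).le (abs_nonneg _), Real.inv_rpow ht.le]
  congr 1
  have : t ^ 2 + ξ ^ 2 ≠ 0 := by positivity
  have : 1 + (t⁻¹ * ξ) ^ 2 ≠ 0 := by positivity
  field_simp

theorem setIntegral_Iic_exp_mul_eq_integral_fourierHat (f : SchwartzMap ℝ ℂ) {t : ℝ} (ht : 0 < t) :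
    ∫ x in Set.Iic (0 : ℝ), Complex.exp (t * x) * f x =
      ((Real.sqrt (2 * Real.pi))⁻¹ : ℝ) *
        ∫ ξ : ℝ, fourierHat f ξ * (t + Complex.I * ξ)⁻¹ := by
  have hre (η : ℝ) : (-(t + 2 * Real.pi * η * Complex.I)).re < 0 := by simp [ht]
  let g : ℝ → ℂ := (Set.Ioi (0 : ℝ)).indicator fun x => Complex.exp (-t * x)
  have hg : Integrable g := by
    refine IntegrableOn.integrable_indicator ?_ measurableSet_Ioi
    exact integrableOn_exp_mul_complex_Ioi (by simpa using ht) 0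
  have hFg (η : ℝ) : FourierTransform.fourier g η = (t + 2 * Real.pi * η * Complex.I)⁻¹ := by
    rw [Real.fourier_real_eq_integral_exp_smul]
    have : (fun v : ℝ => Complex.exp (((-2 * Real.pi * v * η : ℝ) : ℂ) * Complex.I) • g v) =
        (Set.Ioi (0 : ℝ)).indicator
          fun v => Complex.exp (-(t + 2 * Real.pi * η * Complex.I) * v) := by
      ext v
      by_cases hv : v ∈ Set.Ioi (0 : ℝ)
      · simp only [g, Set.indicator_of_mem hv, smul_eq_mul, ← Complex.exp_add]
        congr 1
        push_cast
        ring
      · simp [g, Set.indicator_of_notMem hv]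
    rw [this, integral_indicator measurableSet_Ioi, integral_exp_mul_complex_Ioi (hre η)]
    rw [Complex.ofReal_zero, mul_zero, Complex.exp_zero, neg_div_neg_eq, one_div]
  have hinv (x : ℝ) :
      f x = FourierTransform.fourier (FourierTransform.fourier (f : ℝ → ℂ)) (-x) := by
    rw [← Real.fourierInv_eq_fourier_neg, ← SchwartzMap.fourier_coe, ← SchwartzMap.fourierInv_coe,
      FourierTransform.fourierInv_fourier_eq]
  have hflip := VectorFourier.integral_fourierIntegral_smul_eq_flip (L := innerₗ ℝ)
    (μ := volume) (ν := volume)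
    (f := FourierTransform.fourier (f : ℝ → ℂ)) (g := g)
    Real.continuous_fourierChar continuous_inner
    (by rw [← SchwartzMap.fourier_coe]; exact SchwartzMap.integrable _) hg
  rw [flip_innerₗ] at hflip
  change ∫ x, FourierTransform.fourier (FourierTransform.fourier (f : ℝ → ℂ)) x • g x =
    ∫ η, FourierTransform.fourier (f : ℝ → ℂ) η • FourierTransform.fourier g η at hflip
  have hleft : ∫ x in Set.Iic (0 : ℝ), Complex.exp (t * x) * f x =
      ∫ x, FourierTransform.fourier (FourierTransform.fourier (f : ℝ → ℂ)) x • g x := by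
    have h := integral_comp_neg_Iic (0 : ℝ) fun x : ℝ => Complex.exp (-t * x) *
      FourierTransform.fourier (FourierTransform.fourier (f : ℝ → ℂ)) x
    simp only [← hinv, neg_zero] at h
    rw [← integral_indicator measurableSet_Ioi] at h
    convert h using 4 with x x
    · rw [Complex.ofReal_neg, neg_mul_neg]
    · simp only [g, Set.indicator_apply, smul_eq_mul]
      split_ifs
      · exact mul_comm _ _
      · rw [mul_zero]
  have hpi := Real.pi_pos
  have hsub := Measure.integral_comp_mul_left (fun η : ℝ =>
    FourierTransform.fourier (f : ℝ → ℂ) η * (t + 2 * Real.pi * η * Complex.I : ℂ)⁻¹)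
    (2 * Real.pi)⁻¹
  rw [inv_inv, abs_of_pos (by positivity), Complex.real_smul] at hsub
  rw [hleft, hflip]
  simp only [hFg, smul_eq_mul, fourierHat_eq_fourier, mul_assoc (_ : ℂ) _ (_ : ℂ)⁻¹]
  rw [integral_const_mul, ← mul_assoc, ← Complex.ofReal_mul, ← mul_inv,
    Real.mul_self_sqrt (by positivity)]
  have hc : (Real.pi : ℂ) ≠ 0 := by exact_mod_cast hpi.ne'
  have e (ξ : ℝ) : (t + 2 * Real.pi * (((2 * Real.pi)⁻¹ * ξ : ℝ) : ℂ) * Complex.I : ℂ) =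
      t + Complex.I * ξ := by
    push_cast
    field_simp
  simp only [e] at hsub
  rw [hsub, ← mul_assoc, ← Complex.ofReal_mul, inv_mul_cancel₀ (by positivity),
    Complex.ofReal_one, one_mul]

theorem continuous_fourierHat (f : SchwartzMap ℝ ℂ) : Continuous (fourierHat f) := by
  have : fourierHat f = fun ξ => ((Real.sqrt (2 * Real.pi))⁻¹ : ℝ) *
      FourierTransform.fourier f ((2 * Real.pi)⁻¹ * ξ) := by
    ext ξ
    rw [fourierHat_eq_fourier, SchwartzMap.fourier_coe]
  rw [this]
  fun_prop

theorem enorm_setIntegral_Iic_exp_mul_le (s : ℝ) (f : SchwartzMap ℝ ℂ)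
    (hf : homSobolevNormSq s f ≤ 1) {t : ℝ} (ht : 0 < t) :
    ‖∫ x in Set.Iic (0 : ℝ), Complex.exp (t * x) * f x‖ₑ ≤
      ENNReal.ofReal (Real.sqrt (2 * Real.pi))⁻¹ *
        (ENNReal.ofReal (t ^ (-2 * s - 1)) *
          ∫⁻ ξ : ℝ, ENNReal.ofReal (|ξ| ^ (-2 * s) * (1 + ξ ^ 2)⁻¹)) ^ (1 / 2 : ℝ) := by
  rw [setIntegral_Iic_exp_mul_eq_integral_fourierHat f ht, enorm_mul]
  have e1 : ‖(((Real.sqrt (2 * Real.pi))⁻¹ : ℝ) : ℂ)‖ₑ =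
      ENNReal.ofReal (Real.sqrt (2 * Real.pi))⁻¹ := by
    rw [← ofReal_norm, Complex.norm_real, Real.norm_of_nonneg (by positivity)]
  rw [e1, ← lintegral_abs_rpow_mul_inv_sq_add_sq _ ht]
  gcongr
  refine (enorm_integral_le_lintegral_enorm _).trans ?_
  have hholder := ENNReal.lintegral_mul_le_Lp_mul_Lq (volume : Measure ℝ)
    (Real.HolderConjugate.two_two)
    (f := fun ξ => ‖fourierHat f ξ‖ₑ * ENNReal.ofReal (|ξ| ^ s))
    (g := fun ξ => ENNReal.ofReal (|ξ| ^ (-s)) * ‖(t + Complex.I * ξ : ℂ)⁻¹‖ₑ)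
    (by have := (continuous_fourierHat f).measurable; fun_prop) (by fun_prop)
  have hf1 : ∫⁻ ξ, (‖fourierHat f ξ‖ₑ * ENNReal.ofReal (|ξ| ^ s)) ^ (2 : ℝ) ≤ 1 := by
    refine (lintegral_mono fun ξ => le_of_eq ?_).trans hf
    rw [ENNReal.rpow_two, mul_pow, ← ENNReal.ofReal_pow (by positivity), ← Real.rpow_natCast,
      ← Real.rpow_mul (abs_nonneg _), enorm_eq_nnnorm, Nat.cast_ofNat, mul_comm s]
  have hg1 : ∫⁻ ξ : ℝ, (ENNReal.ofReal (|ξ| ^ (-s)) * ‖(t + Complex.I * ξ : ℂ)⁻¹‖ₑ) ^ (2 : ℝ) =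
      ∫⁻ ξ : ℝ, ENNReal.ofReal (|ξ| ^ (-2 * s) * (t ^ 2 + ξ ^ 2)⁻¹) := by
    congr 1
    ext ξ
    have hn : ‖(t + Complex.I * ξ : ℂ)⁻¹‖ ^ 2 = (t ^ 2 + ξ ^ 2)⁻¹ := by
      rw [norm_inv, inv_pow, Complex.sq_norm, mul_comm, Complex.normSq_add_mul_I]
    rw [ENNReal.rpow_two, ← ofReal_norm, ← ENNReal.ofReal_mul (by positivity),
      ← ENNReal.ofReal_pow (by positivity), mul_pow, hn, ← Real.rpow_natCast,
      ← Real.rpow_mul (abs_nonneg _)]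
    congr 3
    push_cast
    ring
  calc ∫⁻ ξ : ℝ, ‖fourierHat f ξ * (t + Complex.I * ξ : ℂ)⁻¹‖ₑ
      = ∫⁻ ξ, ((fun ξ => ‖fourierHat f ξ‖ₑ * ENNReal.ofReal (|ξ| ^ s)) *
          fun ξ : ℝ => ENNReal.ofReal (|ξ| ^ (-s)) * ‖(t + Complex.I * ξ : ℂ)⁻¹‖ₑ) ξ := by
        refine lintegral_congr_ae ?_
        filter_upwards [Measure.ae_ne volume (0 : ℝ)] with ξ hξ
        have : ENNReal.ofReal (|ξ| ^ s) * ENNReal.ofReal (|ξ| ^ (-s)) = 1 := by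
          rw [← ENNReal.ofReal_mul (by positivity), ← Real.rpow_add (abs_pos.2 hξ), add_neg_cancel,
            Real.rpow_zero, ENNReal.ofReal_one]
        rw [Pi.mul_apply, enorm_mul, mul_assoc, ← mul_assoc (ENNReal.ofReal _), this, one_mul]
    _ ≤ _ := hholder
    _ ≤ 1 * _ := by
        gcongr
        exact ENNReal.rpow_le_one hf1 (by norm_num)
    _ = _ := by rw [one_mul, hg1]

theorem exists_forall_abs_setIntegral_Iic_exp_mul_le {s : ℝ} (hs1 : -(1 / 2) < s)
    (hs2 : s < 1 / 2) :
    ∃ C : ℝ, ∀ φ : ℝ → ℝ, ContDiff ℝ (⊤ : ℕ∞) φ → HasCompactSupport φ →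
      homSobolevNormSq s (fun x => (φ x : ℂ)) ≤ 1 → ∀ t : ℝ, 0 < t →
        |∫ x in Set.Iic (0 : ℝ), Real.exp (t * x) * φ x| ≤ C * t ^ (-s - 1 / 2) := by
  set K : ENNReal := ∫⁻ ξ : ℝ, ENNReal.ofReal (|ξ| ^ (-2 * s) * (1 + ξ ^ 2)⁻¹) with hK
  have hKtop : K ≠ ⊤ :=
    (integrable_abs_rpow_mul_inv_one_add_sq (a := -2 * s) (by linarith)
      (by linarith)).lintegral_lt_top.ne
  refine ⟨(Real.sqrt (2 * Real.pi))⁻¹ * K.toReal ^ (1 / 2 : ℝ), fun φ hφ hφc hn t ht => ?_⟩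
  have hc : HasCompactSupport fun x => (φ x : ℂ) := hφc.comp_left Complex.ofReal_zero
  have hd : ContDiff ℝ (⊤ : ℕ∞) fun x => (φ x : ℂ) := Complex.ofRealCLM.contDiff.comp hφ
  have h := enorm_setIntegral_Iic_exp_mul_le s (hc.toSchwartzMap hd) hn ht
  have e : ∫ x in Set.Iic (0 : ℝ), Complex.exp (t * x) * hc.toSchwartzMap hd x =
      ((∫ x in Set.Iic (0 : ℝ), Real.exp (t * x) * φ x : ℝ) : ℂ) := by
    refine Eq.trans ?_ integral_ofReal
    congr 1
    ext x
    change _ * (φ x : ℂ) = ((Real.exp (t * x) * φ x : ℝ) : ℂ)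
    push_cast
    rfl
  rw [e, ← hK, ← ofReal_norm, Complex.norm_real, Real.norm_eq_abs, ← ENNReal.ofReal_toReal hKtop,
    ← ENNReal.ofReal_mul (by positivity), ENNReal.ofReal_rpow_of_nonneg (by positivity)
    (by norm_num), ← ENNReal.ofReal_mul (by positivity),
    ENNReal.ofReal_le_ofReal_iff (by positivity)] at h
  refine h.trans_eq ?_
  rw [Real.mul_rpow (by positivity) ENNReal.toReal_nonneg, ← Real.rpow_mul ht.le]
  ring_nf

theorem exists_forall_abs_setIntegral_rpow_mul_le {α s : ℝ} (hs1 : -(1 / 2) < s)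
    (hs2 : s < 1 / 2) (hα : 1 / 2 + s < α) :
    ∃ B : ℝ, ∀ φ : ℝ → ℝ, ContDiff ℝ (⊤ : ℕ∞) φ → HasCompactSupport φ →
      homSobolevNormSq s (fun x => (φ x : ℂ)) ≤ 1 →
        |∫ x in Set.Iio (0 : ℝ), (1 - x) ^ (-α) * φ x| ≤ B := by
  obtain ⟨C, hC⟩ := exists_forall_abs_setIntegral_Iic_exp_mul_le hs1 hs2
  have hα0 : 0 < α := by linarith
  have hΓ : 0 < Real.Gamma α := Real.Gamma_pos_of_pos hα0
  refine ⟨(Real.Gamma α)⁻¹ * ∫ t in Set.Ioi (0 : ℝ),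
    C * (Real.exp (-t) * t ^ ((α - s - 1 / 2) - 1)), fun φ hφ hφc hn => ?_⟩
  have hφi : Integrable φ := hφ.continuous.integrable_of_hasCompactSupport hφc
  have hprod : Integrable (Function.uncurry fun x t : ℝ =>
      t ^ (α - 1) * Real.exp (-((1 - x) * t)) * φ x)
      ((volume.restrict (Set.Iic 0)).prod (volume.restrict (Set.Ioi 0))) := by
    refine Integrable.mono (hφi.restrict.mul_prod (Real.GammaIntegral_convergent hα0)) ?_ ?_
    · have := hφ.continuous.measurable
      apply Measurable.aestronglyMeasurable
      simp only [Function.uncurry_def]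
      fun_prop
    · rw [Measure.prod_restrict]
      filter_upwards [ae_restrict_mem (measurableSet_Iic.prod measurableSet_Ioi)] with p hp
      obtain ⟨hx, ht⟩ : p.1 ≤ 0 ∧ 0 < p.2 := hp
      simp only [Function.uncurry_def, norm_mul, Real.norm_eq_abs, Real.abs_exp]
      have : Real.exp (-((1 - p.1) * p.2)) ≤ Real.exp (-p.2) := by
        apply Real.exp_le_exp.2
        nlinarith
      calc _ ≤ |p.2 ^ (α - 1)| * Real.exp (-p.2) * |φ p.1| := by gcongr
        _ = _ := by ring
  have hrep : ∫ x in Set.Iio (0 : ℝ), (1 - x) ^ (-α) * φ x =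
      (Real.Gamma α)⁻¹ * ∫ t in Set.Ioi (0 : ℝ),
        t ^ (α - 1) * Real.exp (-t) * ∫ x in Set.Iic (0 : ℝ), Real.exp (t * x) * φ x := by
    have hswap := integral_integral_swap hprod
    have hl : ∫ x in Set.Iic (0 : ℝ), ∫ t in Set.Ioi (0 : ℝ),
        t ^ (α - 1) * Real.exp (-((1 - x) * t)) * φ x =
        Real.Gamma α * ∫ x in Set.Iic (0 : ℝ), (1 - x) ^ (-α) * φ x := by
      rw [← integral_const_mul]
      refine setIntegral_congr_fun measurableSet_Iic fun x hx => ?_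
      have hx1 : 0 < 1 - x := by linarith [Set.mem_Iic.1 hx]
      rw [integral_mul_const, Real.integral_rpow_mul_exp_neg_mul_Ioi hα0 hx1, one_div,
        Real.inv_rpow hx1.le, Real.rpow_neg hx1.le]
      ring
    have hr : ∫ t in Set.Ioi (0 : ℝ), ∫ x in Set.Iic (0 : ℝ),
        t ^ (α - 1) * Real.exp (-((1 - x) * t)) * φ x = ∫ t in Set.Ioi (0 : ℝ),
        t ^ (α - 1) * Real.exp (-t) * ∫ x in Set.Iic (0 : ℝ), Real.exp (t * x) * φ x := by
      congr 1
      ext t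
      rw [← integral_const_mul]
      congr 1
      ext x
      rw [show -((1 - x) * t) = -t + t * x by ring, Real.exp_add]
      ring
    rw [← integral_Iic_eq_integral_Iio, ← hr, ← hswap, hl, inv_mul_cancel_left₀ hΓ.ne']
  rw [hrep, abs_mul, abs_of_pos (inv_pos.2 hΓ)]
  gcongr
  rw [← Real.norm_eq_abs]
  refine norm_integral_le_of_norm_le
    ((Real.GammaIntegral_convergent (s := α - s - 1 / 2) (by linarith)).const_mul C) ?_
  filter_upwards [ae_restrict_mem measurableSet_Ioi] with t ht
  have ht : 0 < t := ht
  rw [norm_mul, Real.norm_of_nonneg (by positivity), Real.norm_eq_abs]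
  calc _ ≤ t ^ (α - 1) * Real.exp (-t) * (C * t ^ (-s - 1 / 2)) := by
        gcongr
        exact hC φ hφ hφc hn t ht
    _ = C * (Real.exp (-t) * (t ^ (α - 1) * t ^ (-s - 1 / 2))) := by ring
    _ = _ := by
        rw [← Real.rpow_add ht]
        congr 3
        ring

theorem homSobolevNormSq_lt_top {s : ℝ} (hs1 : -(1 / 2) < s) (hs2 : s < 1 / 2)
    (f : SchwartzMap ℝ ℂ) : homSobolevNormSq s f < ⊤ := by
  obtain ⟨A, hA0, hA⟩ := (FourierTransform.fourier f).decay 0 0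
  obtain ⟨B, hB0, hB⟩ := (FourierTransform.fourier f).decay 1 0
  simp only [norm_iteratedFDeriv_zero, pow_zero, pow_one, one_mul, SchwartzMap.fourier_coe]
    at hA hB
  have hK := ((integrable_abs_rpow_mul_inv_one_add_sq (a := 2 * s) (by linarith)
      (by linarith)).const_mul
        ((Real.sqrt (2 * Real.pi))⁻¹ ^ 2 * (A ^ 2 + (2 * Real.pi * B) ^ 2))).lintegral_lt_top
  refine lt_of_le_of_lt (lintegral_mono fun ξ => ?_) hK
  have hpi := Real.pi_pos
  rw [← enorm_eq_nnnorm, ← ofReal_norm, ← ENNReal.ofReal_pow (norm_nonneg _),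
    ← ENNReal.ofReal_mul (by positivity)]
  apply ENNReal.ofReal_le_ofReal
  rw [fourierHat_eq_fourier, norm_mul, Complex.norm_real, Real.norm_of_nonneg (by positivity),
    mul_pow]
  have h1 := hA ((2 * Real.pi)⁻¹ * ξ)
  have h2 := hB ((2 * Real.pi)⁻¹ * ξ)
  set N := ‖FourierTransform.fourier (f : ℝ → ℂ) ((2 * Real.pi)⁻¹ * ξ)‖
  have hN : 0 ≤ N := norm_nonneg _
  rw [norm_mul, Real.norm_of_nonneg (by positivity), mul_assoc, inv_mul_le_iff₀ (by positivity),
    Real.norm_eq_abs] at h2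
  have h3 : N ^ 2 * (1 + ξ ^ 2) ≤ A ^ 2 + (2 * Real.pi * B) ^ 2 := by
    have h4 := pow_le_pow_left₀ hN h1 2
    have h5 := pow_le_pow_left₀ (by positivity) h2 2
    rw [mul_pow, sq_abs] at h5
    linarith
  rw [← le_div_iff₀ (by positivity), div_eq_mul_inv] at h3
  have := Real.rpow_nonneg (abs_nonneg ξ) (2 * s)
  calc _ ≤ (Real.sqrt (2 * Real.pi))⁻¹ ^ 2 * ((A ^ 2 + (2 * Real.pi * B) ^ 2) * (1 + ξ ^ 2)⁻¹) *
        |ξ| ^ (2 * s) := by gcongr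
    _ = _ := by ring

/-- The values of the pairing with `(k - x) ^ (-α)` on the unit ball of `C_0^∞((-∞,0))` in the
homogeneous Sobolev norm of order `s`. -/
def powerKernelPairings (α s k : ℝ) : Set ℝ :=
  {r : ℝ | ∃ φ : ℝ → ℝ, ContDiff ℝ (⊤ : ℕ∞) φ ∧ HasCompactSupport φ ∧
    tsupport φ ⊆ Set.Iio 0 ∧
    homSobolevNormSq s (fun x => (φ x : ℂ)) ≤ 1 ∧
    r = ∫ x in Set.Iio (0 : ℝ), (k - x) ^ (-α) * φ x}

theorem tsupport_comp_inv_mul_subset_Iio {φ : ℝ → ℝ} (h : tsupport φ ⊆ Set.Iio 0) {l : ℝ}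
    (hl : 0 < l) : tsupport (fun x => φ (l⁻¹ * x)) ⊆ Set.Iio 0 := by
  intro x hx
  have := h (tsupport_comp_subset_preimage φ (f := fun x => l⁻¹ * x) (by fun_prop) hx)
  simpa [mul_neg_iff, hl, hl.not_gt] using this

theorem rpow_mul_mem_powerKernelPairings {α s k l r : ℝ} (hk : 0 < k) (hl : 0 < l)
    (hr : r ∈ powerKernelPairings α s k) :
    l ^ (1 / 2 + s - α) * r ∈ powerKernelPairings α s (l * k) := by
  obtain ⟨φ, hφ, hφc, hφs, hn, rfl⟩ := hr
  have hb := Real.rpow_pos_of_pos hl (s - 1 / 2)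
  have hsupp := tsupport_comp_inv_mul_subset_Iio hφs hl
  refine ⟨fun x => l ^ (s - 1 / 2) * φ (l⁻¹ * x), by fun_prop, ?_, ?_, ?_, ?_⟩
  · exact (hφc.comp_homeomorph (Homeomorph.mulLeft₀ l⁻¹ (inv_pos.2 hl).ne')).mul_left
  · exact (tsupport_mul_subset_right (f := fun _ => l ^ (s - 1 / 2))).trans hsupp
  · simp only [Complex.ofReal_mul]
    rw [homSobolevNormSq_const_mul_comp_inv_mul s (fun x => (φ x : ℂ)) hb.le hl, ← Real.rpow_natCast,
      ← Real.rpow_mul hl.le, ← Real.rpow_add hl]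
    have : (s - 1 / 2) * (2 : ℕ) + (1 - 2 * s) = 0 := by push_cast; ring
    rw [this, Real.rpow_zero, ENNReal.ofReal_one, one_mul]
    exact hn
  · have hind : ∀ x, (Set.Iio (0 : ℝ)).indicator
        (fun x => (l * k - x) ^ (-α) * (l ^ (s - 1 / 2) * φ (l⁻¹ * x))) x =
        l ^ (s - 1 / 2 - α) *
          (Set.Iio (0 : ℝ)).indicator (fun x => (k - x) ^ (-α) * φ x) (l⁻¹ * x) := by
      intro x
      by_cases hx : x ∈ Set.Iio (0 : ℝ)
      · have hx' : l⁻¹ * x ∈ Set.Iio (0 : ℝ) := mul_neg_of_pos_of_neg (inv_pos.2 hl) hx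
        rw [Set.indicator_of_mem hx, Set.indicator_of_mem hx']
        have : l * k - x = l * (k - l⁻¹ * x) := by field_simp
        rw [this, Real.mul_rpow hl.le (by linarith [Set.mem_Iio.1 hx']), sub_eq_add_neg (s - 1 / 2),
          Real.rpow_add hl]
        ring
      · have hx' : l⁻¹ * x ∉ Set.Iio (0 : ℝ) :=
          not_lt.2 (mul_nonneg (inv_pos.2 hl).le (not_lt.1 hx))
        rw [Set.indicator_of_notMem hx, Set.indicator_of_notMem hx', mul_zero]
    rw [← integral_indicator measurableSet_Iio, ← integral_indicator measurableSet_Iio]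
    simp only [hind]
    rw [integral_const_mul, Measure.integral_comp_mul_left, inv_inv, abs_of_pos hl, smul_eq_mul,
      ← mul_assoc]
    congr 1
    rw [← Real.rpow_add_one hl.ne']
    congr 1
    ring

open scoped Pointwise in
theorem powerKernelPairings_eq_smul {α s k : ℝ} (hk : 0 < k) :
    powerKernelPairings α s k = k ^ (1 / 2 + s - α) • powerKernelPairings α s 1 := by
  ext r
  rw [Set.mem_smul_set_iff_inv_smul_mem₀ (Real.rpow_pos_of_pos hk _).ne', smul_eq_mul,
    ← Real.inv_rpow hk.le]
  constructor
  · intro h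
    simpa [inv_mul_cancel₀ hk.ne'] using rpow_mul_mem_powerKernelPairings hk (inv_pos.2 hk) h
  · intro h
    have := rpow_mul_mem_powerKernelPairings one_pos hk h
    rwa [mul_one, ← mul_assoc, ← Real.mul_rpow hk.le (inv_pos.2 hk).le, mul_inv_cancel₀ hk.ne',
      Real.one_rpow, one_mul] at this

theorem exists_pos_mem_powerKernelPairings_one {α s : ℝ} (hs1 : -(1 / 2) < s) (hs2 : s < 1 / 2)
    (hα : 0 ≤ α) : ∃ r ∈ powerKernelPairings α s 1, 0 < r := by
  obtain ⟨f, hfs, hfc, hf, hfr, hf1⟩ :=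
    exists_contDiff_tsupport_subset (n := ⊤) (Iio_mem_nhds (show (-1 : ℝ) < 0 by norm_num))
  have hf0 (x : ℝ) : 0 ≤ f x := (hfr ⟨x, rfl⟩).1
  have hc : HasCompactSupport fun x => (f x : ℂ) := hfc.comp_left Complex.ofReal_zero
  have hd : ContDiff ℝ (⊤ : ℕ∞) fun x => (f x : ℂ) := Complex.ofRealCLM.contDiff.comp hf
  have hN : homSobolevNormSq s (fun x => (f x : ℂ)) < ⊤ :=
    homSobolevNormSq_lt_top hs1 hs2 (hc.toSchwartzMap hd)
  set N := homSobolevNormSq s (fun x => (f x : ℂ))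
  set b : ℝ := (N.toReal + 1)⁻¹
  have hN0 : 0 ≤ N.toReal := ENNReal.toReal_nonneg
  have hb : 0 < b := by positivity
  have hpos : 0 < ∫ x in Set.Iio (0 : ℝ), (1 - x) ^ (-α) * f x := by
    rw [setIntegral_pos_iff_support_of_nonneg_ae]
    · have hsub : Function.support f ⊆
          Function.support (fun x => (1 - x) ^ (-α) * f x) ∩ Set.Iio 0 := by
        intro x hx
        have hx0 : x < 0 := hfs (subset_tsupport f hx)
        exact ⟨mul_ne_zero (Real.rpow_pos_of_pos (by linarith) _).ne' hx, hx0⟩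
      refine lt_of_lt_of_le ?_ (measure_mono hsub)
      exact hf.continuous.isOpen_support.measure_pos _ ⟨-1, by simp [hf1]⟩
    · filter_upwards [ae_restrict_mem measurableSet_Iio] with x hx
      have : 0 < 1 - x := by linarith [Set.mem_Iio.1 hx]
      exact mul_nonneg (Real.rpow_nonneg this.le _) (hf0 x)
    · have hfi : Integrable f := hf.continuous.integrable_of_hasCompactSupport hfc
      have := hf.continuous.measurable
      refine Integrable.mono' hfi.restrict (by fun_prop) ?_
      filter_upwards [ae_restrict_mem measurableSet_Iio] with x hx
      have h1 : 1 ≤ 1 - x := by linarith [Set.mem_Iio.1 hx]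
      rw [Real.norm_of_nonneg (mul_nonneg (Real.rpow_nonneg (by linarith) _) (hf0 x))]
      exact mul_le_of_le_one_left (hf0 x) (Real.rpow_le_one_of_one_le_of_nonpos h1 (by linarith))
  refine ⟨b * ∫ x in Set.Iio (0 : ℝ), (1 - x) ^ (-α) * f x,
    ⟨fun x => b * f x, by fun_prop, hfc.mul_left, ?_, ?_, ?_⟩, mul_pos hb hpos⟩
  · exact (tsupport_mul_subset_right (f := fun _ => b)).trans hfs
  · have h := homSobolevNormSq_const_mul_comp_inv_mul s (fun x => (f x : ℂ)) hb.le one_pos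
    simp only [inv_one, one_mul, Real.one_rpow, mul_one] at h
    simp only [Complex.ofReal_mul]
    rw [h]
    change _ * N ≤ 1
    rw [← ENNReal.ofReal_toReal hN.ne, ← ENNReal.ofReal_mul (by positivity),
      ENNReal.ofReal_le_one]
    have hb1 : b ≤ 1 := inv_le_one_of_one_le₀ (by linarith)
    have hbN : b * N.toReal ≤ 1 := by
      rw [inv_mul_le_iff₀ (by positivity)]
      linarith
    calc b ^ 2 * N.toReal = b * (b * N.toReal) := by ring
      _ ≤ 1 := mul_le_one₀ hb1 (by positivity) hbN
  · rw [← integral_const_mul]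
    congr 1
    ext x
    ring

/-- For `s ∈ (−1/2,1/2)`, `α > 1/2 + s`, `α ≠ 1` and `k > 0`:
`sup { ∫_{−∞}^0 (k−x)^{−α} φ(x) dx : φ ∈ C_0^∞((−∞,0)), ‖φ‖_{W̃^{s,2}} ≤ 1 }
  = c(α,s) k^{1/2+s−α}` with a finite positive constant `c(α,s)` independent of `k`. -/
theorem sup_pairing_power_kernel (α s : ℝ)
    (hs1 : -(1 / 2) < s) (hs2 : s < 1 / 2) (hα : 1 / 2 + s < α) (hα1 : α ≠ 1) :
    ∃ c : ℝ, 0 < c ∧ ∀ k : ℝ, 0 < k →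
      sSup {r : ℝ | ∃ φ : ℝ → ℝ, ContDiff ℝ (⊤ : ℕ∞) φ ∧ HasCompactSupport φ ∧
          tsupport φ ⊆ Set.Iio 0 ∧
          homSobolevNormSq s (fun x => (φ x : ℂ)) ≤ 1 ∧
          r = ∫ x in Set.Iio (0 : ℝ), (k - x) ^ (-α) * φ x} =
        c * k ^ (1 / 2 + s - α) := by
  obtain ⟨B, hB⟩ := exists_forall_abs_setIntegral_rpow_mul_le hs1 hs2 hα
  have hbdd : BddAbove (powerKernelPairings α s 1) := by
    refine ⟨B, ?_⟩
    rintro r ⟨φ, hφ, hφc, -, hn, rfl⟩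
    exact (le_abs_self _).trans (hB φ hφ hφc hn)
  obtain ⟨r, hr, hr0⟩ := exists_pos_mem_powerKernelPairings_one (α := α) hs1 hs2 (by linarith)
  refine ⟨sSup (powerKernelPairings α s 1), hr0.trans_le (le_csSup hbdd hr), fun k hk => ?_⟩
  change sSup (powerKernelPairings α s k) = _
  rw [powerKernelPairings_eq_smul hk, Real.sSup_smul_of_nonneg (Real.rpow_nonneg hk.le _),
    smul_eq_mul, mul_comm]
end
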